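/- With the Q-polynomial distance-regular graph setup and the split subspaces Ṽ^{μν}_{i,j}, for 0 ≤ i,j,r,s ≤ D the subspaces Ṽ^{↓↑}_{i,j} and Ṽ^{↑↓}_{r,s} are orthogonal with respect to the standard Hermitian form unless i + r = D and j + s = D. -/

import Mathlib

noncomputable section

open Matrix Finset
open scoped ComplexInnerProductSpace

/-- A `Q`-polynomial distance-regular graph setup: a finite connected simple graph `G` on `X`
with diameter `D ≥ 3`, intersection numbers `p h i j`, primitive idempotents
`E 0, …, E D` of the Bose–Mesner algebra with (distinct, real) eigenvalues `θ 0, …, θ D`,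
and Krein parameters `q h i j` satisfying the `Q`-polynomial condition with respect to the
ordering `E 0, …, E D`. -/
structure QPolyDRG (X : Type*) [Fintype X] [DecidableEq X] where
  G : SimpleGraph X
  conn : G.Connected
  D : ℕ
  hD3 : 3 ≤ D
  dist_le : ∀ y z : X, G.dist y z ≤ D
  dist_eq : ∃ y z : X, G.dist y z = D
  p : ℕ → ℕ → ℕ → ℕ
  hp : ∀ h i j : ℕ, h ≤ D → i ≤ D → j ≤ D → ∀ y z : X, G.dist y z = h →
    Nat.card {w : X // G.dist y w = i ∧ G.dist w z = j} = p h i j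
  E : ℕ → Matrix X X ℂ
  θ : ℕ → ℝ
  q : ℕ → ℕ → ℕ → ℝ
  hE0 : E 0 = ((Fintype.card X : ℂ))⁻¹ • Matrix.of (fun _ _ => (1 : ℂ))
  hEsum : ∑ i ∈ Finset.range (D + 1), E i = 1
  hEmul : ∀ i ≤ D, ∀ j ≤ D, E i * E j = if i = j then E i else 0
  hEsym : ∀ i ≤ D, (E i)ᵀ = E i
  hEreal : ∀ i ≤ D, ∀ y z : X, ((E i) y z).im = 0
  hEinM : ∀ i ≤ D, E i ∈ Submodule.span ℂ
    {B : Matrix X X ℂ | ∃ k ≤ D, B = Matrix.of (fun y z => if G.dist y z = k then (1 : ℂ) else 0)}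
  hAE : ∀ i ≤ D,
    Matrix.of (fun y z => if G.dist y z = 1 then (1 : ℂ) else 0) * E i = (θ i : ℂ) • E i
  θ_inj : ∀ i ≤ D, ∀ j ≤ D, θ i = θ j → i = j
  hKrein : ∀ i ≤ D, ∀ j ≤ D, Matrix.hadamard (E i) (E j) =
    ((Fintype.card X : ℂ))⁻¹ • ∑ h ∈ Finset.range (D + 1), (q h i j : ℂ) • E h
  hq_zero : ∀ h ≤ D, ∀ i ≤ D, ∀ j ≤ D, (i + j < h ∨ h + j < i ∨ h + i < j) → q h i j = 0
  hq_ne : ∀ h ≤ D, ∀ i ≤ D, ∀ j ≤ D, (h = i + j ∨ i = h + j ∨ j = h + i) → q h i j ≠ 0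

namespace QPolyDRG

variable {X : Type*} [Fintype X] [DecidableEq X] (S : QPolyDRG X) (x : X)

/-- The `i`-th distance matrix `A_i`. -/
def Amat (i : ℕ) : Matrix X X ℂ :=
  Matrix.of (fun y z => if S.G.dist y z = i then (1 : ℂ) else 0)

/-- The adjacency matrix `A = A_1`. -/
def adj : Matrix X X ℂ := S.Amat 1

/-- The `i`-th dual idempotent `E*_i = E*_i(x)` with respect to the base vertex `x`. -/
def Estar (i : ℕ) : Matrix X X ℂ :=
  Matrix.diagonal (fun y => if S.G.dist x y = i then (1 : ℂ) else 0)

/-- The dual adjacency matrix `A* = A*(x)`, with `(A*)_{yy} = |X| (E_1)_{xy}`. -/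
def Astar : Matrix X X ℂ :=
  Matrix.diagonal (fun y => (Fintype.card X : ℂ) * S.E 1 x y)

/-- The subspace `E_i V` of the standard module, with the convention that it is `0`
for `i ∉ {0, …, D}`. -/
def EV (i : ℤ) : Submodule ℂ (EuclideanSpace ℂ X) :=
  if 0 ≤ i ∧ i ≤ S.D then LinearMap.range (Matrix.toEuclideanLin (S.E i.toNat)) else ⊥

/-- The `i`-th subconstituent `E*_i V` with respect to `x`, with the convention that it is `0`
for `i ∉ {0, …, D}`. -/
def EstarV (i : ℤ) : Submodule ℂ (EuclideanSpace ℂ X) :=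
  if 0 ≤ i ∧ i ≤ S.D then LinearMap.range (Matrix.toEuclideanLin (S.Estar x i.toNat)) else ⊥

/-- The subconstituent (Terwilliger) algebra `T = T(x)`, generated by `A` and `A*`. -/
def Talg : Subalgebra ℂ (Matrix X X ℂ) := Algebra.adjoin ℂ {S.adj, S.Astar x}

/-- A `T`-module: a subspace `W ⊆ V` with `B W ⊆ W` for all `B ∈ T`. -/
def IsTModule (W : Submodule ℂ (EuclideanSpace ℂ X)) : Prop :=
  ∀ B ∈ S.Talg x, ∀ w ∈ W, Matrix.toEuclideanLin B w ∈ W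

/-- An irreducible `T`-module. -/
def IsIrredTModule (W : Submodule ℂ (EuclideanSpace ℂ X)) : Prop :=
  S.IsTModule x W ∧ W ≠ ⊥ ∧ ∀ W' ≤ W, S.IsTModule x W' → W' = ⊥ ∨ W' = W

/-- The subspace `E_i W`, with the convention that it is `0` for `i ∉ {0, …, D}`. -/
def EW (W : Submodule ℂ (EuclideanSpace ℂ X)) (i : ℤ) : Submodule ℂ (EuclideanSpace ℂ X) :=
  if 0 ≤ i ∧ i ≤ S.D then Submodule.map (Matrix.toEuclideanLin (S.E i.toNat)) W else ⊥

/-- The subspace `E*_i W`, with the convention that it is `0` for `i ∉ {0, …, D}`. -/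
def EstarW (W : Submodule ℂ (EuclideanSpace ℂ X)) (i : ℤ) : Submodule ℂ (EuclideanSpace ℂ X) :=
  if 0 ≤ i ∧ i ≤ S.D then Submodule.map (Matrix.toEuclideanLin (S.Estar x i.toNat)) W else ⊥


/-- The endpoint `ρ = min { i : E*_i W ≠ 0 }` of a `T`-module `W`. -/
def endpt (W : Submodule ℂ (EuclideanSpace ℂ X)) : ℕ :=
  sInf {i : ℕ | i ≤ S.D ∧ S.EstarW x W i ≠ ⊥}

/-- The dual endpoint `τ = min { i : E_i W ≠ 0 }` of a `T`-module `W`. -/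
def dualEndpt (W : Submodule ℂ (EuclideanSpace ℂ X)) : ℕ :=
  sInf {i : ℕ | i ≤ S.D ∧ S.EW W i ≠ ⊥}

/-- The diameter `d = |{ i : E*_i W ≠ 0 }| - 1` of a `T`-module `W`. -/
def diam (W : Submodule ℂ (EuclideanSpace ℂ X)) : ℕ :=
  Set.ncard {i : ℕ | i ≤ S.D ∧ S.EstarW x W i ≠ ⊥} - 1

/-- The dual diameter `|{ i : E_i W ≠ 0 }| - 1` of a `T`-module `W`. -/
def dualDiam (W : Submodule ℂ (EuclideanSpace ℂ X)) : ℕ :=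
  Set.ncard {i : ℕ | i ≤ S.D ∧ S.EW W i ≠ ⊥} - 1

/-- The split subspace `W^{μν}_h` of an irreducible `T`-module `W` with endpoint `ρ`,
dual endpoint `τ` and diameter `d`.  Here `μ = false` stands for `↓` and `μ = true`
for `↑`, and similarly for `ν`; e.g.
`W^{↓↓}_h = (E*_ρ W + ⋯ + E*_{ρ+h} W) ∩ (E_τ W + ⋯ + E_{τ+d-h} W)`. -/
def Wsplit (W : Submodule ℂ (EuclideanSpace ℂ X)) (ρ τ d : ℕ) (μ ν : Bool) (h : ℕ) :
    Submodule ℂ (EuclideanSpace ℂ X) :=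
  (if μ then ⨆ k ∈ Finset.Icc (ρ + d - h) (ρ + d), S.EstarW x W k
    else ⨆ k ∈ Finset.Icc ρ (ρ + h), S.EstarW x W k) ⊓
  (if ν then ⨆ k ∈ Finset.Icc (τ + h) (τ + d), S.EW W k
    else ⨆ k ∈ Finset.Icc τ (τ + d - h), S.EW W k)

/-- The subspace `V^{μν}_{i,j}` (interpreted as `0` if `i = -1` or `j = -1`).
Here `μ = false` stands for `↓` and `μ = true` for `↑`, and similarly for `ν`; e.g.
`V^{↓↓}_{i,j} = (E*_0 V + ⋯ + E*_i V) ∩ (E_0 V + ⋯ + E_j V)` and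
`V^{↑↑}_{i,j} = (E*_D V + ⋯ + E*_{D-i} V) ∩ (E_D V + ⋯ + E_{D-j} V)`. -/
def Vsplit (μ ν : Bool) (i j : ℤ) : Submodule ℂ (EuclideanSpace ℂ X) :=
  if 0 ≤ i ∧ 0 ≤ j then
    (if μ then ⨆ k ∈ Finset.Icc (S.D - i.toNat) S.D, S.EstarV x k
      else ⨆ k ∈ Finset.range (i.toNat + 1), S.EstarV x k) ⊓
    (if ν then ⨆ k ∈ Finset.Icc (S.D - j.toNat) S.D, S.EV k
      else ⨆ k ∈ Finset.range (j.toNat + 1), S.EV k)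
  else ⊥

/-- The subspace `Ṽ^{μν}_{i,j}`: the orthogonal complement of
`V^{μν}_{i-1,j} + V^{μν}_{i,j-1}` in `V^{μν}_{i,j}` with respect to the standard
Hermitian form. -/
def tildeV (μ ν : Bool) (i j : ℕ) : Submodule ℂ (EuclideanSpace ℂ X) :=
  S.Vsplit x μ ν i j ⊓ (S.Vsplit x μ ν ((i : ℤ) - 1) j ⊔ S.Vsplit x μ ν i ((j : ℤ) - 1))ᗮ

end QPolyDRG

namespace TDAux

open scoped ComplexInnerProductSpace

variable {V : Type*} [NormedAddCommGroup V] [InnerProductSpace ℂ V]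

structure Half (D : ℕ) (P : ℕ → V →ₗ[ℂ] V) : Prop where
  sa : ∀ i ≤ D, ∀ u v : V, ⟪P i u, v⟫ = ⟪u, P i v⟫
  mul : ∀ i ≤ D, ∀ j ≤ D, ∀ v : V, P i (P j v) = if i = j then P i v else 0
  sum : ∀ v : V, ∑ i ∈ Finset.range (D + 1), P i v = v

structure TD (D : ℕ) (P Q : ℕ → V →ₗ[ℂ] V) (A B : V →ₗ[ℂ] V) (θ θs : ℕ → ℂ) : Prop where
  hP : Half D P
  hQ : Half D Q
  triA : ∀ h ≤ D, ∀ l ≤ D, (l + 1 < h ∨ h + 1 < l) → ∀ v, P h (A (P l v)) = 0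
  triB : ∀ h ≤ D, ∀ l ≤ D, (l + 1 < h ∨ h + 1 < l) → ∀ v, Q h (B (Q l v)) = 0
  eigA : ∀ h ≤ D, ∀ v, Q h (A v) = θ h • Q h v
  eigB : ∀ h ≤ D, ∀ v, P h (B v) = θs h • P h v
  polA : ∀ W : Submodule ℂ V, (∀ w ∈ W, A w ∈ W) → ∀ h ≤ D, ∀ w ∈ W, Q h w ∈ W
  polB : ∀ W : Submodule ℂ V, (∀ w ∈ W, B w ∈ W) → ∀ h ≤ D, ∀ w ∈ W, P h w ∈ W

theorem TD.swap {D : ℕ} {P Q : ℕ → V →ₗ[ℂ] V} {A B : V →ₗ[ℂ] V} {θ θs : ℕ → ℂ}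
    (T : TD D P Q A B θ θs) : TD D Q P B A θs θ :=
  ⟨T.hQ, T.hP, T.triB, T.triA, T.eigB, T.eigA, T.polB, T.polA⟩

/-- Vectors with no component above `i`. -/
def Fl (D : ℕ) (P : ℕ → V →ₗ[ℂ] V) (i : ℤ) : Submodule ℂ V where
  carrier := {v | ∀ h ≤ D, i < (h : ℤ) → P h v = 0}
  add_mem' := by
    intro a b ha hb h hh hi
    rw [map_add, ha h hh hi, hb h hh hi, add_zero]
  zero_mem' := by intro h _ _; exact map_zero _
  smul_mem' := by
    intro c a ha h hh hi
    rw [map_smul, ha h hh hi, smul_zero]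

/-- Vectors with no component below `k`. -/
def Gl (D : ℕ) (P : ℕ → V →ₗ[ℂ] V) (k : ℤ) : Submodule ℂ V where
  carrier := {v | ∀ h ≤ D, (h : ℤ) < k → P h v = 0}
  add_mem' := by
    intro a b ha hb h hh hi
    rw [map_add, ha h hh hi, hb h hh hi, add_zero]
  zero_mem' := by intro h _ _; exact map_zero _
  smul_mem' := by
    intro c a ha h hh hi
    rw [map_smul, ha h hh hi, smul_zero]

theorem mem_Fl {D : ℕ} {P : ℕ → V →ₗ[ℂ] V} {i : ℤ} {v : V} :
    v ∈ Fl D P i ↔ ∀ h ≤ D, i < (h : ℤ) → P h v = 0 := Iff.rfl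

theorem mem_Gl {D : ℕ} {P : ℕ → V →ₗ[ℂ] V} {i : ℤ} {v : V} :
    v ∈ Gl D P i ↔ ∀ h ≤ D, (h : ℤ) < i → P h v = 0 := Iff.rfl

theorem Fl_mono {D : ℕ} {P : ℕ → V →ₗ[ℂ] V} {i j : ℤ} (h : i ≤ j) : Fl D P i ≤ Fl D P j :=
  fun _ hv l hl hj => hv l hl (lt_of_le_of_lt h hj)

theorem Gl_mono {D : ℕ} {P : ℕ → V →ₗ[ℂ] V} {i j : ℤ} (h : i ≤ j) : Gl D P j ≤ Gl D P i :=
  fun _ hv l hl hj => hv l hl (lt_of_lt_of_le hj h)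

def Vs (D : ℕ) (P Q : ℕ → V →ₗ[ℂ] V) (i k : ℤ) : Submodule ℂ V := Fl D P i ⊓ Gl D Q k

def Us (D : ℕ) (P Q : ℕ → V →ₗ[ℂ] V) (n : ℤ) : Submodule ℂ V :=
  ⨆ t : {t : ℤ × ℤ // t.1 - t.2 ≤ n}, Vs D P Q t.1.1 t.1.2

theorem Vs_le_Us {D : ℕ} {P Q : ℕ → V →ₗ[ℂ] V} {i k n : ℤ} (h : i - k ≤ n) :
    Vs D P Q i k ≤ Us D P Q n :=
  le_iSup (fun t : {t : ℤ × ℤ // t.1 - t.2 ≤ n} => Vs D P Q t.1.1 t.1.2) ⟨(i, k), h⟩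

theorem Us_le {D : ℕ} {P Q : ℕ → V →ₗ[ℂ] V} {i k n : ℤ} (h : n + 1 ≤ i - k) :
    Us D P Q n ≤ Fl D P (i - 1) ⊔ Gl D Q (k + 1) := by
  refine iSup_le ?_
  rintro ⟨⟨i', k'⟩, ht⟩
  simp only at ht ⊢
  by_cases hi : i' ≤ i - 1
  · exact (inf_le_left.trans (Fl_mono hi)).trans le_sup_left
  · exact (inf_le_right.trans (Gl_mono (by omega))).trans le_sup_right

theorem Half.expand {D : ℕ} {P : ℕ → V →ₗ[ℂ] V} (H : Half D P) (L : V →ₗ[ℂ] V) (v : V)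
    (h0 : ∀ l ≤ D, L (P l v) = 0) : L v = 0 := by
  rw [← H.sum v, map_sum]
  exact Finset.sum_eq_zero fun l hl => h0 l (by simpa [Nat.lt_succ_iff] using hl)

theorem Half.inner_zero {D : ℕ} {P : ℕ → V →ₗ[ℂ] V} (H : Half D P) {i k : ℤ} (hik : i < k)
    {u v : V} (hu : u ∈ Fl D P i) (hv : v ∈ Gl D P k) : ⟪u, v⟫ = 0 := by
  rw [← H.sum v, inner_sum]
  refine Finset.sum_eq_zero fun l hl => ?_
  have hl : l ≤ D := by simpa [Nat.lt_succ_iff] using hl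
  by_cases h : i < l
  · rw [← H.sa l hl, hu l hl h, inner_zero_left]
  · rw [hv l hl (by omega), inner_zero_right]

variable {D : ℕ} {P Q : ℕ → V →ₗ[ℂ] V} {A B : V →ₗ[ℂ] V} {θ θs : ℕ → ℂ}

theorem TD.A_mem (T : TD D P Q A B θ θs) {i k : ℤ} {v : V} (hv : v ∈ Vs D P Q i k) :
    A v - θ k.toNat • v ∈ Vs D P Q (i + 1) (k + 1) := by
  constructor
  · intro h hh hi
    have h1 : P h v = 0 := hv.1 h hh (by omega)
    have h2 : P h (A v) = 0 := by
      refine T.hP.expand (P h ∘ₗ A) v fun l hl => ?_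
      by_cases hli : i < l
      · rw [hv.1 l hl hli, map_zero]
      · exact T.triA h hh l hl (by omega) v
    rw [map_sub, map_smul, h1, h2]; simp
  · intro h hh hi
    rw [map_sub, map_smul, T.eigA h hh]
    by_cases hk : (h : ℤ) < k
    · rw [hv.2 h hh hk]; simp
    · have : k.toNat = h := by omega
      rw [this, sub_self]

theorem TD.B_mem (T : TD D P Q A B θ θs) {i k : ℤ} {v : V} (hv : v ∈ Vs D P Q i k) :
    B v - θs i.toNat • v ∈ Vs D P Q (i - 1) (k - 1) := by
  constructor
  · intro h hh hi
    rw [map_sub, map_smul, T.eigB h hh]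
    by_cases hk : i < (h : ℤ)
    · rw [hv.1 h hh hk]; simp
    · have : i.toNat = h := by omega
      rw [this, sub_self]
  · intro h hh hi
    have h1 : Q h v = 0 := hv.2 h hh (by omega)
    have h2 : Q h (B v) = 0 := by
      refine T.hQ.expand (Q h ∘ₗ B) v fun l hl => ?_
      by_cases hli : (l : ℤ) < k
      · rw [hv.2 l hl hli, map_zero]
      · exact T.triB h hh l hl (by omega) v
    rw [map_sub, map_smul, h1, h2]; simp

theorem TD.Us_A (T : TD D P Q A B θ θs) (n : ℤ) : ∀ w ∈ Us D P Q n, A w ∈ Us D P Q n := by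
  suffices Us D P Q n ≤ (Us D P Q n).comap A from this
  refine iSup_le ?_
  rintro ⟨⟨i, k⟩, ht⟩ v hv
  simp only at ht hv
  have h1 := Vs_le_Us (n := n) (by omega) (T.A_mem hv)
  have h2 := (Us D P Q n).smul_mem (θ k.toNat) (Vs_le_Us ht hv)
  simpa using add_mem h1 h2

theorem TD.Us_B (T : TD D P Q A B θ θs) (n : ℤ) : ∀ w ∈ Us D P Q n, B w ∈ Us D P Q n := by
  suffices Us D P Q n ≤ (Us D P Q n).comap B from this
  refine iSup_le ?_
  rintro ⟨⟨i, k⟩, ht⟩ v hv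
  simp only at ht hv
  have h1 := Vs_le_Us (n := n) (by omega) (T.B_mem hv)
  have h2 := (Us D P Q n).smul_mem (θs i.toNat) (Vs_le_Us ht hv)
  simpa using add_mem h1 h2

def Inv (D : ℕ) (P : ℕ → V →ₗ[ℂ] V) (W : Submodule ℂ V) : Prop :=
  ∀ h ≤ D, ∀ w ∈ W, P h w ∈ W

theorem Inv.inf {W W' : Submodule ℂ V} (h : Inv D P W) (h' : Inv D P W') : Inv D P (W ⊓ W') :=
  fun l hl w hw => ⟨h l hl w hw.1, h' l hl w hw.2⟩

theorem Inv.orth (H : Half D P) {W : Submodule ℂ V} (h : Inv D P W) : Inv D P Wᗮ := by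
  intro l hl w hw
  rw [Submodule.mem_orthogonal] at hw ⊢
  intro u hu
  rw [← H.sa l hl]
  exact hw _ (h l hl u hu)

theorem TD.invP (T : TD D P Q A B θ θs) (n : ℤ) : Inv D P (Us D P Q n) :=
  T.polB _ (T.Us_B n)

theorem TD.invQ (T : TD D P Q A B θ θs) (n : ℤ) : Inv D Q (Us D P Q n) :=
  T.polA _ (T.Us_A n)

theorem zero_of_mem {K : Submodule ℂ V} {v : V} (h1 : v ∈ K) (h2 : v ∈ Kᗮ) : v = 0 := by
  have := (Submodule.mem_orthogonal K v).1 h2 v h1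
  exact inner_self_eq_zero.1 this

theorem Inv.comp_zero (H : Half D P) {W : Submodule ℂ V} (h : Inv D P W) {a b : V}
    (ha : a ∈ W) (hb : b ∈ Wᗮ) {l : ℕ} (hl : l ≤ D) (h0 : P l (a + b) = 0) : P l a = 0 := by
  refine zero_of_mem (h l hl a ha) ?_
  rw [map_add] at h0
  rw [eq_neg_of_add_eq_zero_left h0]
  exact neg_mem (h.orth H l hl b hb)

variable [FiniteDimensional ℂ V]

theorem TD.tilde_orth (T : TD D P Q A B θ θs) {i k : ℤ} {u : V} (hu : u ∈ Vs D P Q i k)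
    (h1 : ∀ w ∈ Vs D P Q (i - 1) k, ⟪w, u⟫ = 0) (h2 : ∀ w ∈ Vs D P Q i (k + 1), ⟪w, u⟫ = 0) :
    u ∈ (Us D P Q (i - k - 1))ᗮ := by
  obtain ⟨a, ha, b, hb, rfl⟩ := (Us D P Q (i - k - 1)).exists_add_mem_mem_orthogonal u
  have haF : a ∈ Fl D P i := fun l hl hi => (T.invP _).comp_zero T.hP ha hb hl (hu.1 l hl hi)
  have haG : a ∈ Gl D Q k := fun l hl hi => (T.invQ _).comp_zero T.hQ ha hb hl (hu.2 l hl hi)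
  obtain ⟨f, hf, g, hg, hfg⟩ := Submodule.mem_sup.1 (Us_le (i := i) (k := k) (by omega) ha)
  have hf' : f ∈ Gl D Q k := by
    rw [eq_sub_of_add_eq hfg]
    exact sub_mem haG (Gl_mono (by omega) hg)
  have hg' : g ∈ Fl D P i := by
    rw [eq_sub_of_add_eq' hfg]
    exact sub_mem haF (Fl_mono (by omega) hf)
  have h3 : ⟪a, a + b⟫ = 0 := by
    conv_lhs => rw [← hfg]
    rw [inner_add_left, hfg, h1 f ⟨hf, hf'⟩, h2 g ⟨hg', hg⟩, add_zero]
  rw [inner_add_right, (Submodule.mem_orthogonal _ b).1 hb a ha, add_zero] at h3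
  rw [inner_self_eq_zero.1 h3, zero_add]
  exact hb

theorem TD.orth_le (T : TD D P Q A B θ θs) {n m : ℤ} (hnm : -1 ≤ n + m) :
    (Us D P Q n)ᗮ ≤ Us D Q P m := by
  classical
  set U := Us D P Q n with hU
  set U' := Us D Q P m with hU'
  have iP : Inv D P U := T.invP n
  have iQ : Inv D Q U := T.invQ n
  have iP' : Inv D P U' := T.swap.invQ m
  have iQ' : Inv D Q U' := T.swap.invP m
  set K := Uᗮ ⊓ U' with hK
  have jP : Inv D P (Kᗮ ⊓ Uᗮ) := (((iP.orth T.hP).inf iP').orth T.hP).inf (iP.orth T.hP)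
  have jQ : Inv D Q (Kᗮ ⊓ Uᗮ) := (((iQ.orth T.hQ).inf iQ').orth T.hQ).inf (iQ.orth T.hQ)
  have hW : Kᗮ ⊓ Uᗮ = ⊥ := by
    by_contra hne
    obtain ⟨w, hw, hw0⟩ := Submodule.exists_mem_ne_zero_of_ne_bot hne
    have eP : ∃ h, h ≤ D ∧ ∃ w ∈ Kᗮ ⊓ Uᗮ, P h w ≠ 0 := by
      by_contra hc
      push Not at hc
      exact hw0 (T.hP.expand LinearMap.id w fun l hl => hc l hl w hw)
    have eQ : ∃ h, h ≤ D ∧ ∃ w ∈ Kᗮ ⊓ Uᗮ, Q h w ≠ 0 := by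
      by_contra hc
      push Not at hc
      exact hw0 (T.hQ.expand LinearMap.id w fun l hl => hc l hl w hw)
    obtain ⟨hρ, wρ, hwρ, hwρ0⟩ := Nat.find_spec eP
    obtain ⟨hτ, wτ, hwτ, hwτ0⟩ := Nat.find_spec eQ
    have mP : ∀ h ≤ D, h < Nat.find eP → ∀ w ∈ Kᗮ ⊓ Uᗮ, P h w = 0 := by
      intro h hh hl w hw
      by_contra h0
      exact Nat.find_min eP hl ⟨hh, w, hw, h0⟩
    have mQ : ∀ h ≤ D, h < Nat.find eQ → ∀ w ∈ Kᗮ ⊓ Uᗮ, Q h w = 0 := by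
      intro h hh hl w hw
      by_contra h0
      exact Nat.find_min eQ hl ⟨hh, w, hw, h0⟩
    generalize Nat.find eP = ρ at *
    generalize Nat.find eQ = τ at *
    by_cases hc : (ρ : ℤ) - τ ≤ n
    · apply hwρ0
      have hm := jP ρ hρ wρ hwρ
      refine zero_of_mem (K := U) (Vs_le_Us hc ⟨?_, ?_⟩) hm.2
      · intro h hh hl
        rw [T.hP.mul h hh ρ hρ, if_neg (by omega)]
      · intro h hh hl
        exact mQ h hh (by omega) _ hm
    · apply hwτ0
      have hm := jQ τ hτ wτ hwτ
      refine zero_of_mem (K := K) ⟨hm.2, Vs_le_Us (i := τ) (k := ρ) (by omega) ⟨?_, ?_⟩⟩ hm.1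
      · intro h hh hl
        rw [T.hQ.mul h hh τ hτ, if_neg (by omega)]
      · intro h hh hl
        exact mP h hh (by omega) _ hm
  have := Submodule.sup_orthogonal_inf_of_hasOrthogonalProjection (K₁ := K) (K₂ := Uᗮ) inf_le_left
  rw [hW, sup_bot_eq] at this
  rw [← this]
  exact inf_le_right

theorem TD.main (T : TD D P Q A B θ θs) {i k a b : ℤ} {u v : V} (hu : u ∈ Vs D P Q i k)
    (h1 : ∀ w ∈ Vs D P Q (i - 1) k, ⟪w, u⟫ = 0) (h2 : ∀ w ∈ Vs D P Q i (k + 1), ⟪w, u⟫ = 0)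
    (hv : v ∈ Vs D Q P b a)
    (h3 : ∀ w ∈ Vs D Q P (b - 1) a, ⟪w, v⟫ = 0) (h4 : ∀ w ∈ Vs D Q P b (a + 1), ⟪w, v⟫ = 0)
    (hne : ¬ (i = a ∧ k = b)) : ⟪u, v⟫ = 0 := by
  by_cases c1 : i < a
  · exact T.hP.inner_zero c1 hu.1 hv.2
  by_cases c2 : b < k
  · rw [inner_eq_zero_symm]
    exact T.hQ.inner_zero c2 hv.1 hu.2
  have hu' := T.tilde_orth hu h1 h2
  have hv' := T.swap.tilde_orth hv h3 h4
  exact (Submodule.mem_orthogonal _ v).1 hv' u (T.orth_le (by omega) hu')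

end TDAux

namespace TDAux

theorem aeval_mem {V : Type*} [AddCommGroup V] [Module ℂ V] (A : V →ₗ[ℂ] V)
    (W : Submodule ℂ V) (hW : ∀ w ∈ W, A w ∈ W) (p : Polynomial ℂ) (w : V) (hw : w ∈ W) :
    Polynomial.aeval A p w ∈ W := by
  induction p using Polynomial.induction_on' generalizing w with
  | add p q hp hq =>
    rw [map_add, LinearMap.add_apply]
    exact add_mem (hp w hw) (hq w hw)
  | monomial n a =>
    rw [Polynomial.aeval_monomial, Module.End.mul_apply, Module.algebraMap_end_apply]
    refine W.smul_mem _ ?_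
    induction n generalizing w with
    | zero => simpa using hw
    | succ n ih =>
      rw [pow_succ, Module.End.mul_apply]
      exact ih _ (hW w hw)

theorem aeval_eig {V : Type*} [AddCommGroup V] [Module ℂ V] (A Q : V →ₗ[ℂ] V) (t : ℂ)
    (hA : ∀ v, Q (A v) = t • Q v) (p : Polynomial ℂ) (w : V) :
    Q (Polynomial.aeval A p w) = p.eval t • Q w := by
  induction p using Polynomial.induction_on' generalizing w with
  | add p q hp hq =>
    rw [map_add, LinearMap.add_apply, map_add, hp, hq, Polynomial.eval_add, add_smul]
  | monomial n a =>
    rw [Polynomial.aeval_monomial, Module.End.mul_apply, Module.algebraMap_end_apply, map_smul,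
      Polynomial.eval_monomial, mul_smul]
    congr 1
    induction n generalizing w with
    | zero => simp
    | succ n ih =>
      rw [pow_succ, Module.End.mul_apply, ih, hA, smul_smul, pow_succ]

theorem pol_of {V : Type*} [NormedAddCommGroup V] [InnerProductSpace ℂ V] {D : ℕ}
    {Q : ℕ → V →ₗ[ℂ] V} (H : Half D Q) {A : V →ₗ[ℂ] V} {θ : ℕ → ℂ}
    (eig : ∀ h ≤ D, ∀ v, Q h (A v) = θ h • Q h v)
    (inj : ∀ i ≤ D, ∀ j ≤ D, Q i ≠ 0 → Q j ≠ 0 → θ i = θ j → i = j)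
    (W : Submodule ℂ V) (hW : ∀ w ∈ W, A w ∈ W) : ∀ h ≤ D, ∀ w ∈ W, Q h w ∈ W := by
  classical
  intro h hh w hw
  by_cases h0 : Q h = 0
  · rw [h0]; exact W.zero_mem
  set s : Finset ℕ := (Finset.range (D + 1)).filter fun i => Q i ≠ 0 with hs
  have hinj : Set.InjOn θ s := by
    intro i hi j hj hij
    simp only [hs, Finset.coe_filter, Finset.mem_range, Set.mem_ofPred_eq] at hi hj
    exact inj i (by omega) j (by omega) hi.2 hj.2 hij
  have hmem : h ∈ s := by
    rw [hs, Finset.mem_filter, Finset.mem_range]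
    exact ⟨by omega, h0⟩
  have key : Polynomial.aeval A (Lagrange.basis s θ h) w = Q h w := by
    rw [← H.sum (Polynomial.aeval A (Lagrange.basis s θ h) w)]
    rw [Finset.sum_eq_single h]
    · rw [aeval_eig A (Q h) (θ h) (eig h hh), Lagrange.eval_basis_self hinj hmem, one_smul]
    · intro i hi hne
      rw [Finset.mem_range] at hi
      by_cases hi0 : Q i = 0
      · rw [hi0]; rfl
      have him : i ∈ s := by
        rw [hs, Finset.mem_filter, Finset.mem_range]
        exact ⟨hi, hi0⟩
      rw [aeval_eig A (Q i) (θ i) (eig i (by omega)), Lagrange.eval_basis_of_ne hne.symm him,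
        zero_smul]
    · intro hn
      exact absurd (Finset.mem_range.2 (by omega)) hn
  rw [← key]
  exact aeval_mem A W hW _ w hw

end TDAux

namespace QPolyDRG

variable {X : Type*} [Fintype X] [DecidableEq X] (S : QPolyDRG X) (x : X)

theorem tl_mul (M N : Matrix X X ℂ) (v : EuclideanSpace ℂ X) :
    toEuclideanLin M (toEuclideanLin N v) = toEuclideanLin (M * N) v := by
  ext y
  simp [toEuclideanLin, Matrix.mulVec_mulVec]

theorem tl_sa (M : Matrix X X ℂ) (hM : Mᴴ = M) (u v : EuclideanSpace ℂ X) :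
    ⟪toEuclideanLin M u, v⟫ = ⟪u, toEuclideanLin M v⟫ :=
  (Matrix.isSymmetric_toEuclideanLin_iff.2 hM) u v

theorem E_herm {i : ℕ} (hi : i ≤ S.D) : (S.E i)ᴴ = S.E i := by
  ext y z
  rw [Matrix.conjTranspose_apply]
  have h1 : S.E i z y = S.E i y z := by
    conv_lhs => rw [← S.hEsym i hi]
    rfl
  rw [h1]
  exact Complex.conj_eq_iff_im.2 (S.hEreal i hi y z)

theorem E_symm {i : ℕ} (hi : i ≤ S.D) (y z : X) : S.E i y z = S.E i z y := by
  conv_lhs => rw [← S.hEsym i hi]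
  rfl

theorem adj_E {i : ℕ} (hi : i ≤ S.D) : S.adj * S.E i = (S.θ i : ℂ) • S.E i := S.hAE i hi

theorem adj_symm : (S.adj)ᵀ = S.adj := by
  ext y z
  simp only [adj, Amat, Matrix.transpose_apply, Matrix.of_apply]
  rw [S.G.dist_comm]

theorem E_adj {i : ℕ} (hi : i ≤ S.D) : S.E i * S.adj = (S.θ i : ℂ) • S.E i := by
  have := congrArg Matrix.transpose (S.adj_E hi)
  rwa [Matrix.transpose_mul, Matrix.transpose_smul, S.hEsym i hi, S.adj_symm] at this

theorem E_dist {i : ℕ} (hi : i ≤ S.D) :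
    ∃ c : ℕ → ℂ, ∀ y z, S.E i y z = c (S.G.dist y z) := by
  have h := S.hEinM i hi
  generalize S.E i = M0 at h ⊢
  induction h using Submodule.span_induction with
  | mem M hM =>
    obtain ⟨k, _, rfl⟩ := hM
    exact ⟨fun d => if d = k then 1 else 0, fun y z => rfl⟩
  | zero => exact ⟨0, fun y z => rfl⟩
  | add M N _ _ hM hN =>
    obtain ⟨c, hc⟩ := hM
    obtain ⟨d, hd⟩ := hN
    exact ⟨c + d, fun y z => by simp [hc, hd]⟩
  | smul a M _ hM =>
    obtain ⟨c, hc⟩ := hM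
    exact ⟨a • c, fun y z => by simp [hc]⟩

theorem Estar_mul (i j : ℕ) :
    S.Estar x i * S.Estar x j = if i = j then S.Estar x i else 0 := by
  rw [Estar, Estar, Matrix.diagonal_mul_diagonal]
  split_ifs with h
  · subst h
    congr 1; ext y; split_ifs <;> simp
  · rw [← Matrix.diagonal_zero]
    congr 1; ext y
    by_cases h1 : S.G.dist x y = i
    · rw [if_neg (by omega : ¬ S.G.dist x y = j)]; simp
    · simp [h1]

theorem Estar_herm (i : ℕ) : (S.Estar x i)ᴴ = S.Estar x i := by
  rw [Estar, Matrix.diagonal_conjTranspose]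
  congr 1; ext y
  simp only [Pi.star_apply]
  split_ifs <;> simp

theorem Estar_sum : ∑ i ∈ Finset.range (S.D + 1), S.Estar x i = 1 := by
  ext y z
  rw [Matrix.sum_apply]
  by_cases h : y = z
  · subst h
    have := S.dist_le x y
    simp [Estar, Nat.lt_succ_iff, this]
  · simp [Estar, h]

theorem Estar_adj {h l : ℕ} (hhl : l + 1 < h ∨ h + 1 < l) :
    S.Estar x h * S.adj * S.Estar x l = 0 := by
  ext y z
  rw [Estar, Estar, Matrix.mul_diagonal, Matrix.diagonal_mul]
  simp only [adj, Amat, Matrix.of_apply, Matrix.zero_apply]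
  by_cases h1 : S.G.dist x y = h
  · by_cases h2 : S.G.dist x z = l
    · by_cases h3 : S.G.dist y z = 1
      · have t1 := S.conn.dist_triangle (u := x) (v := y) (w := z)
        have t2 := S.conn.dist_triangle (u := x) (v := z) (w := y)
        rw [S.G.dist_comm (u := z)] at t2
        omega
      · simp [h3]
    · simp [h2]
  · simp [h1]

open scoped ComplexOrder in
theorem E_Astar {h l : ℕ} (hh : h ≤ S.D) (hl : l ≤ S.D) (hhl : l + 1 < h ∨ h + 1 < l) :
    S.E h * S.Astar x * S.E l = 0 := by
  have h1D : 1 ≤ S.D := by have := S.hD3; omega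
  have hA : (S.Astar x)ᴴ = S.Astar x := by
    rw [Astar, Matrix.diagonal_conjTranspose]
    congr 1; ext y
    simp only [Pi.star_apply, star_mul']
    rw [show star (S.E 1 x y) = S.E 1 x y from
      Complex.conj_eq_iff_im.2 (S.hEreal 1 h1D x y)]
    simp
  rw [← Matrix.trace_mul_conjTranspose_self_eq_zero_iff]
  rw [Matrix.conjTranspose_mul, Matrix.conjTranspose_mul, S.E_herm hh, S.E_herm hl, hA]
  have e1 : S.E h * S.Astar x * S.E l * (S.E l * (S.Astar x * S.E h))
      = S.E h * (S.Astar x * S.E l * S.Astar x * S.E h) := by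
    have : S.E l * S.E l = S.E l := by rw [S.hEmul l hl l hl, if_pos rfl]
    calc _ = S.E h * S.Astar x * (S.E l * S.E l) * (S.Astar x * S.E h) := by
          simp only [Matrix.mul_assoc]
      _ = _ := by rw [this]; simp only [Matrix.mul_assoc]
  rw [e1, Matrix.trace_mul_comm, Matrix.mul_assoc _ (S.E h), S.hEmul h hh h hh, if_pos rfl]
  set c : X → ℂ := fun y => (Fintype.card X : ℂ) * S.E 1 x y with hc
  have e2 : (S.Astar x * S.E l * S.Astar x * S.E h).trace
      = c ⬝ᵥ (Matrix.hadamard (S.E h) (S.E l)) *ᵥ c := by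
    simp only [Matrix.trace, Matrix.diag, dotProduct, Matrix.mulVec]
    refine Finset.sum_congr rfl fun y _ => ?_
    rw [Matrix.mul_apply, Finset.mul_sum]
    refine Finset.sum_congr rfl fun z _ => ?_
    rw [Astar, Matrix.mul_diagonal, Matrix.diagonal_mul, Matrix.hadamard_apply, S.E_symm hh y z]
    simp only [hc]
    ring
  rw [e2, S.hKrein h hh l hl, Matrix.smul_mulVec, dotProduct_smul]
  have e3 : (∑ m ∈ Finset.range (S.D + 1), (S.q m h l : ℂ) • S.E m) *ᵥ c = 0 := by
    rw [Matrix.sum_mulVec]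
    refine Finset.sum_eq_zero fun m hm => ?_
    have hm : m ≤ S.D := by simpa [Nat.lt_succ_iff] using hm
    rw [Matrix.smul_mulVec]
    by_cases h1 : m = 1
    · subst h1
      rw [S.hq_zero 1 hm h hh l hl (by omega)]
      simp
    · have : S.E m *ᵥ c = 0 := by
        ext y
        have h2 : (S.E m * S.E 1) y x = 0 := by
          rw [S.hEmul m hm 1 h1D, if_neg h1]; rfl
        rw [Matrix.mul_apply] at h2
        simp only [Matrix.mulVec, dotProduct, hc, Pi.zero_apply]
        calc _ = (Fintype.card X : ℂ) * ∑ j, S.E m y j * S.E 1 j x := by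
              rw [Finset.mul_sum]
              refine Finset.sum_congr rfl fun z _ => ?_
              rw [S.E_symm h1D x z]; ring
          _ = 0 := by rw [h2, mul_zero]
      rw [this, smul_zero]
  rw [e3]
  simp

theorem adj_pow (n : ℕ) :
    S.adj ^ n = ∑ i ∈ Finset.range (S.D + 1), ((S.θ i : ℂ) ^ n) • S.E i := by
  induction n with
  | zero => simp [S.hEsum]
  | succ n ih =>
    rw [pow_succ', ih, Finset.mul_sum]
    refine Finset.sum_congr rfl fun i hi => ?_
    have hi : i ≤ S.D := by simpa [Nat.lt_succ_iff] using hi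
    rw [Matrix.mul_smul, S.adj_E hi, smul_smul, pow_succ]

theorem adj_eq [DecidableRel S.G.Adj] : S.adj = S.G.adjMatrix ℂ := by
  ext y z
  simp only [adj, Amat, Matrix.of_apply, SimpleGraph.adjMatrix_apply, SimpleGraph.dist_eq_one_iff_adj]

theorem pow_ne {y z : X} : (S.adj ^ S.G.dist y z) y z ≠ 0 := by
  classical
  rw [S.adj_eq, SimpleGraph.adjMatrix_pow_apply_eq_card_walk]
  obtain ⟨w, hw⟩ := S.conn.exists_walk_length_eq_dist y z
  rw [Nat.cast_ne_zero]
  exact (Fintype.card_pos_iff.2 ⟨⟨w, hw⟩⟩).ne'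

theorem pow_eq {y z : X} {n : ℕ} (hn : n < S.G.dist y z) : (S.adj ^ n) y z = 0 := by
  classical
  rw [S.adj_eq, SimpleGraph.adjMatrix_pow_apply_eq_card_walk]
  rw [Nat.cast_eq_zero, Fintype.card_eq_zero_iff]
  refine ⟨fun w => ?_⟩
  have h1 := SimpleGraph.dist_le w.1
  have h2 : w.1.length = n := w.2
  omega

theorem E_eq_of {y z : X} (h : S.E 1 x y = S.E 1 x z) :
    ∀ i ≤ S.D, S.E i x y = S.E i x z := by
  have h1D : 1 ≤ S.D := by have := S.hD3; omega
  have hcard : (Fintype.card X : ℂ) ≠ 0 := by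
    have : Nonempty X := ⟨x⟩
    exact_mod_cast Fintype.card_ne_zero
  intro i
  induction i using Nat.strong_induction_on with
  | _ i ih =>
    intro hi
    rcases i with _ | i
    · rw [S.hE0]; rfl
    have hiD : i ≤ S.D := by omega
    have hk : ∀ w, S.E 1 x w * S.E i x w = (Fintype.card X : ℂ)⁻¹ *
        (∑ m ∈ Finset.range (i + 1), (S.q m 1 i : ℂ) * S.E m x w
          + (S.q (i + 1) 1 i : ℂ) * S.E (i + 1) x w) := by
      intro w
      have := congrFun (congrFun (S.hKrein 1 h1D i hiD) x) w
      rw [Matrix.hadamard_apply, Matrix.smul_apply, Matrix.sum_apply, smul_eq_mul] at this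
      rw [this, ← Finset.sum_range_succ (fun m => (S.q m 1 i : ℂ) * S.E m x w)]
      congr 1
      symm
      refine Finset.sum_subset ?_ ?_
      · intro m hm
        rw [Finset.mem_range] at hm ⊢
        omega
      · intro m hm hm'
        rw [Finset.mem_range] at hm hm'
        rw [S.hq_zero m (by omega) 1 h1D i hiD (by omega)]
        simp
    have hy := hk y
    have hz := hk z
    rw [h, ih i (by omega) hiD, hz] at hy
    have hsum : ∑ m ∈ Finset.range (i + 1), (S.q m 1 i : ℂ) * S.E m x y
        = ∑ m ∈ Finset.range (i + 1), (S.q m 1 i : ℂ) * S.E m x z := by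
      refine Finset.sum_congr rfl fun m hm => ?_
      rw [Finset.mem_range] at hm
      rw [ih m hm (by omega)]
    rw [hsum] at hy
    have hq : (S.q (i + 1) 1 i : ℂ) ≠ 0 := by
      exact_mod_cast S.hq_ne (i + 1) hi 1 h1D i hiD (by omega)
    have h2 := add_left_cancel (mul_left_cancel₀ (inv_ne_zero hcard) hy)
    exact (mul_left_cancel₀ hq h2).symm

theorem dist_inj {y z : X} (h : S.E 1 x y = S.E 1 x z) : S.G.dist x y = S.G.dist x z := by
  have hE := S.E_eq_of x h
  have hpow : ∀ n, (S.adj ^ n) x y = (S.adj ^ n) x z := by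
    intro n
    rw [S.adj_pow, Matrix.sum_apply, Matrix.sum_apply]
    refine Finset.sum_congr rfl fun i hi => ?_
    have hi : i ≤ S.D := by simpa [Nat.lt_succ_iff] using hi
    rw [Matrix.smul_apply, Matrix.smul_apply, hE i hi]
  rcases lt_trichotomy (S.G.dist x y) (S.G.dist x z) with hlt | heq | hgt
  · exact absurd ((hpow _).trans (S.pow_eq hlt)) S.pow_ne
  · exact heq
  · exact absurd ((hpow _).symm.trans (S.pow_eq hgt)) S.pow_ne

theorem halfP : TDAux.Half S.D (fun i => toEuclideanLin (S.Estar x i)) where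
  sa i _ := tl_sa _ (S.Estar_herm x i)
  mul i _ j _ v := by
    rw [tl_mul, Estar_mul]
    split_ifs <;> simp
  sum v := by
    rw [← LinearMap.sum_apply, ← map_sum, S.Estar_sum]
    ext y; simp [toEuclideanLin]

theorem halfQ : TDAux.Half S.D (fun i => toEuclideanLin (S.E i)) where
  sa i hi := tl_sa _ (S.E_herm hi)
  mul i hi j hj v := by
    rw [tl_mul, S.hEmul i hi j hj]
    split_ifs <;> simp
  sum v := by
    rw [← LinearMap.sum_apply, ← map_sum, S.hEsum]
    ext y; simp [toEuclideanLin]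

theorem td : ∃ θs : ℕ → ℂ, TDAux.TD S.D (fun i => toEuclideanLin (S.Estar x i))
    (fun i => toEuclideanLin (S.E i)) (toEuclideanLin S.adj) (toEuclideanLin (S.Astar x))
    (fun i => (S.θ i : ℂ)) θs := by
  have h1D : 1 ≤ S.D := by have := S.hD3; omega
  have hcard : (Fintype.card X : ℂ) ≠ 0 := by
    have : Nonempty X := ⟨x⟩
    exact_mod_cast Fintype.card_ne_zero
  obtain ⟨c, hc⟩ := S.E_dist h1D
  have eigA : ∀ h ≤ S.D, ∀ v, toEuclideanLin (S.E h) (toEuclideanLin S.adj v)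
      = (S.θ h : ℂ) • toEuclideanLin (S.E h) v := by
    intro h hh v
    rw [tl_mul, S.E_adj hh, map_smul, LinearMap.smul_apply]
  have eigB : ∀ h ≤ S.D, ∀ v, toEuclideanLin (S.Estar x h) (toEuclideanLin (S.Astar x) v)
      = ((Fintype.card X : ℂ) * c h) • toEuclideanLin (S.Estar x h) v := by
    intro h hh v
    rw [tl_mul, ← LinearMap.smul_apply, ← map_smul]
    congr 2
    rw [Estar, Astar, Matrix.diagonal_mul_diagonal, ← Matrix.diagonal_smul]
    congr 1; ext y
    rw [hc]
    by_cases hy : S.G.dist x y = h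
    · simp [hy]
    · simp [hy]
  have ex : ∀ i, toEuclideanLin (S.Estar x i) ≠ 0 → ∃ y, S.G.dist x y = i := by
    intro i hi
    by_contra hn
    push Not at hn
    apply hi
    have : S.Estar x i = 0 := by
      rw [Estar, ← Matrix.diagonal_zero]
      congr 1; ext y; simp [hn y]
    rw [this, map_zero]
  refine ⟨fun h => (Fintype.card X : ℂ) * c h, S.halfP x, S.halfQ, ?_, ?_, eigA, eigB, ?_, ?_⟩
  · intro h _ l _ hhl v
    rw [tl_mul, tl_mul, S.Estar_adj x hhl]
    simp
  · intro h hh l hl hhl v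
    rw [tl_mul, tl_mul, S.E_Astar x hh hl hhl]
    simp
  · intro W hW
    refine TDAux.pol_of S.halfQ eigA ?_ W hW
    intro i hi j hj _ _ hij
    exact S.θ_inj i hi j hj (by exact_mod_cast hij)
  · intro W hW
    refine TDAux.pol_of (S.halfP x) eigB ?_ W hW
    intro i hi j hj hi0 hj0 hij
    obtain ⟨y, rfl⟩ := ex i hi0
    obtain ⟨z, rfl⟩ := ex j hj0
    apply S.dist_inj x
    rw [hc, hc]
    exact mul_left_cancel₀ hcard hij

theorem sup_range {D : ℕ} {P : ℕ → EuclideanSpace ℂ X →ₗ[ℂ] EuclideanSpace ℂ X}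
    (H : TDAux.Half D P) (Z : ℤ → Submodule ℂ (EuclideanSpace ℂ X))
    (hZ : ∀ k : ℕ, k ≤ D → Z k = LinearMap.range (P k)) (i : ℕ) (hi : i ≤ D) :
    ⨆ k ∈ Finset.range (i + 1), Z (k : ℕ) = TDAux.Fl D P i := by
  apply le_antisymm
  · refine iSup₂_le fun k hk => ?_
    rw [Finset.mem_range] at hk
    rw [hZ k (by omega)]
    rintro _ ⟨v, rfl⟩ h hh hl
    rw [H.mul h hh k (by omega), if_neg (by omega)]
  · intro v hv
    rw [← H.sum v]
    refine Submodule.sum_mem _ fun k hk => ?_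
    rw [Finset.mem_range] at hk
    by_cases hki : k ≤ i
    · refine (le_iSup₂_of_le (f := fun k (_ : k ∈ Finset.range (i + 1)) => Z (k : ℕ)) k
        (Finset.mem_range.2 (by omega)) le_rfl) ?_
      rw [hZ k (by omega)]
      exact ⟨v, rfl⟩
    · rw [hv k (by omega) (by omega)]
      exact zero_mem _

theorem sup_Icc {D : ℕ} {P : ℕ → EuclideanSpace ℂ X →ₗ[ℂ] EuclideanSpace ℂ X}
    (H : TDAux.Half D P) (Z : ℤ → Submodule ℂ (EuclideanSpace ℂ X))
    (hZ : ∀ k : ℕ, k ≤ D → Z k = LinearMap.range (P k)) (i : ℕ) (hi : i ≤ D) :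
    ⨆ k ∈ Finset.Icc (D - i) D, Z (k : ℕ) = TDAux.Gl D P ((D : ℤ) - i) := by
  apply le_antisymm
  · refine iSup₂_le fun k hk => ?_
    rw [Finset.mem_Icc] at hk
    rw [hZ k (by omega)]
    rintro _ ⟨v, rfl⟩ h hh hl
    rw [H.mul h hh k (by omega), if_neg (by omega)]
  · intro v hv
    rw [← H.sum v]
    refine Submodule.sum_mem _ fun k hk => ?_
    rw [Finset.mem_range] at hk
    by_cases hki : D - i ≤ k
    · refine (le_iSup₂_of_le (f := fun k (_ : k ∈ Finset.Icc (D - i) D) => Z (k : ℕ)) k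
        (Finset.mem_Icc.2 (by omega)) le_rfl) ?_
      rw [hZ k (by omega)]
      exact ⟨v, rfl⟩
    · rw [hv k (by omega) (by omega)]
      exact zero_mem _

theorem EV_eq (k : ℕ) (hk : k ≤ S.D) : S.EV k = LinearMap.range (toEuclideanLin (S.E k)) := by
  rw [EV, if_pos ⟨by omega, by omega⟩, Int.toNat_natCast]

theorem EstarV_eq (k : ℕ) (hk : k ≤ S.D) :
    S.EstarV x k = LinearMap.range (toEuclideanLin (S.Estar x k)) := by
  rw [EstarV, if_pos ⟨by omega, by omega⟩, Int.toNat_natCast]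

theorem Vs_bot {D : ℕ} {P Q : ℕ → EuclideanSpace ℂ X →ₗ[ℂ] EuclideanSpace ℂ X}
    (HP : TDAux.Half D P) (HQ : TDAux.Half D Q) {i k : ℤ} (h : i < 0 ∨ (D : ℤ) < k) :
    TDAux.Vs D P Q i k = ⊥ := by
  rw [eq_bot_iff]
  intro v hv
  rw [Submodule.mem_bot]
  rcases h with h | h
  · exact HP.expand LinearMap.id v fun l hl => hv.1 l hl (by omega)
  · exact HQ.expand LinearMap.id v fun l hl => hv.2 l hl (by omega)

theorem Vsplit_du (i j : ℤ) (hi : i ≤ S.D) (hj : j ≤ S.D) :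
    S.Vsplit x false true i j = TDAux.Vs S.D (fun i => toEuclideanLin (S.Estar x i))
      (fun i => toEuclideanLin (S.E i)) i (S.D - j) := by
  by_cases h : 0 ≤ i ∧ 0 ≤ j
  · obtain ⟨h1, h2⟩ := h
    lift i to ℕ using h1
    lift j to ℕ using h2
    rw [Vsplit, if_pos (by omega)]
    simp only [Bool.false_eq_true, if_false, if_true, Int.toNat_natCast]
    rw [sup_range (S.halfP x) (S.EstarV x) (S.EstarV_eq x) i (by omega),
      sup_Icc S.halfQ S.EV S.EV_eq j (by omega)]
    rfl
  · rw [Vsplit, if_neg h, Vs_bot (S.halfP x) S.halfQ (by omega)]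

theorem Vsplit_ud (i j : ℤ) (hi : i ≤ S.D) (hj : j ≤ S.D) :
    S.Vsplit x true false i j = TDAux.Vs S.D (fun i => toEuclideanLin (S.E i))
      (fun i => toEuclideanLin (S.Estar x i)) j (S.D - i) := by
  by_cases h : 0 ≤ i ∧ 0 ≤ j
  · obtain ⟨h1, h2⟩ := h
    lift i to ℕ using h1
    lift j to ℕ using h2
    rw [Vsplit, if_pos (by omega)]
    simp only [Bool.false_eq_true, if_false, if_true, Int.toNat_natCast]
    rw [sup_range S.halfQ S.EV S.EV_eq j (by omega),
      sup_Icc (S.halfP x) (S.EstarV x) (S.EstarV_eq x) i (by omega), inf_comm]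
    rfl
  · rw [Vsplit, if_neg h, Vs_bot S.halfQ (S.halfP x) (by omega)]

end QPolyDRG

open QPolyDRG in
/-- `Ṽ^{↓↑}_{i,j}` and `Ṽ^{↑↓}_{r,s}` are orthogonal with respect to the standard
Hermitian form unless `i + r = D` and `j + s = D`. -/
theorem drg_tildeV_duality_du_ud {X : Type*} [Fintype X] [DecidableEq X]
    (S : QPolyDRG X) (x : X) :
    ∀ i : ℕ, i ≤ S.D → ∀ j : ℕ, j ≤ S.D → ∀ r : ℕ, r ≤ S.D → ∀ s : ℕ, s ≤ S.D →
      ¬(i + r = S.D ∧ j + s = S.D) →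
      ∀ u ∈ S.tildeV x false true i j, ∀ v ∈ S.tildeV x true false r s,
        ⟪u, v⟫ = 0 := by
  intro i hi j hj r hr s hs hne u hu v hv
  obtain ⟨θs, T⟩ := S.td x
  obtain ⟨hu1, hu2⟩ := hu
  obtain ⟨hv1, hv2⟩ := hv
  rw [SetLike.mem_coe, Submodule.mem_orthogonal] at hu2 hv2
  rw [SetLike.mem_coe, S.Vsplit_du x _ _ (by omega) (by omega)] at hu1
  rw [SetLike.mem_coe, S.Vsplit_ud x _ _ (by omega) (by omega)] at hv1
  rw [S.Vsplit_du x _ _ (by omega) (by omega), S.Vsplit_du x _ _ (by omega) (by omega)] at hu2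
  rw [S.Vsplit_ud x _ _ (by omega) (by omega), S.Vsplit_ud x _ _ (by omega) (by omega)] at hv2
  refine T.main hu1 (fun w hw => hu2 w (Submodule.mem_sup_left hw))
    (fun w hw => hu2 w (Submodule.mem_sup_right ?_)) hv1
    (fun w hw => hv2 w (Submodule.mem_sup_right hw))
    (fun w hw => hv2 w (Submodule.mem_sup_left ?_)) (by omega)
  · rwa [show (S.D : ℤ) - ((j : ℤ) - 1) = S.D - j + 1 by ring]
  · rwa [show (S.D : ℤ) - ((r : ℤ) - 1) = S.D - r + 1 by ring]

end
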